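/- arXiv:1705.02443 — 6 statements merged into one kernel-verified Lean document; each statement's English description precedes it below -/
import Mathlib

section
/- (Extension; Lemma 1(ii)) Let M be a positioning of a finite family A of rectangles with corners (aᵢ, bᵢ), and let Δx > 0. Let A′ be the family obtained from A by replacing w₁ with w₁ + Δx, and let W be the assignment giving rectangle 1 the corner (a₁, b₁), and for k > 1 giving rectangle k the corner (aₖ + Δx, bₖ) if aₖ ≥ a₁ + w₁ and (aₖ, bₖ) otherwise. Then W is a positioning of A′ (the open interiors remain pairwise disjoint) and T(W) ≤ T(M) + q(M)·Δx. -/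
open Set Finset Function

/-- A positioning of a family of rectangles (widths `w`, heights `l`) assigns
lower-left corners `(a i, b i)` so that the open interiors are pairwise disjoint. -/
def IsPositioning {ι : Type*} (w l a b : ι → ℝ) : Prop :=
  ∀ i j, i ≠ j →
    Disjoint (Set.Ioo (a i) (a i + w i) ×ˢ Set.Ioo (b i) (b i + l i))
             (Set.Ioo (a j) (a j + w j) ×ˢ Set.Ioo (b j) (b j + l j))

/-- Horizontal extent `p(M) = max_{i,j} ((a i + w i) - a j)`. -/
noncomputable def pval {n : ℕ} (w a : Fin n → ℝ) : ℝ :=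
  ⨆ i, ⨆ j, (a i + w i - a j)

/-- Vertical extent `q(M) = max_{i,j} ((b i + l i) - b j)`. -/
noncomputable def qval {n : ℕ} (l b : Fin n → ℝ) : ℝ :=
  ⨆ i, ⨆ j, (b i + l i - b j)

/-- Bounding area `T(M) = p(M) * q(M)`. -/
noncomputable def Tval {n : ℕ} (w l a b : Fin n → ℝ) : ℝ :=
  pval w a * qval l b

/-- Total area `S(A) = ∑ i, w i * l i`. -/
noncomputable def Sval {n : ℕ} (w l : Fin n → ℝ) : ℝ :=
  ∑ i, w i * l i

/-- Packing efficiency `η(M) = S(A) / T(M)`. -/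
noncomputable def eta {n : ℕ} (w l a b : Fin n → ℝ) : ℝ :=
  Sval w l / Tval w l a b

/-- Best packing efficiency `η₀(A) = sup over positionings M of η(M)`. -/
noncomputable def eta0 {n : ℕ} (w l : Fin n → ℝ) : ℝ :=
  sSup {e | ∃ a b : Fin n → ℝ, IsPositioning w l a b ∧ e = eta w l a b}

/-- Minimal bounding area `T₀(A) = inf over positionings M of T(M)`. -/
noncomputable def T0 {n : ℕ} (w l : Fin n → ℝ) : ℝ :=
  sInf {t | ∃ a b : Fin n → ℝ, IsPositioning w l a b ∧ t = Tval w l a b}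

theorem disjoint_Ioo_add_iff {x y u v : ℝ} (hu : 0 < u) (hv : 0 < v) :
    Disjoint (Set.Ioo x (x + u)) (Set.Ioo y (y + v)) ↔ x + u ≤ y ∨ y + v ≤ x := by
  rw [Set.Ioo_disjoint_Ioo]
  grind

theorem isPositioning_iff {ι : Type*} {w l a b : ι → ℝ}
    (hw : ∀ i, 0 < w i) (hl : ∀ i, 0 < l i) :
    IsPositioning w l a b ↔ ∀ i j, i ≠ j →
      (a i + w i ≤ a j ∨ a j + w j ≤ a i) ∨ (b i + l i ≤ b j ∨ b j + l j ≤ b i) := by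
  simp only [IsPositioning, Set.disjoint_prod, disjoint_Ioo_add_iff, hw, hl]

theorem le_pval {n : ℕ} (w a : Fin n → ℝ) (i j : Fin n) : a i + w i - a j ≤ pval w a :=
  (le_ciSup (f := fun j => a i + w i - a j) (Set.finite_range _).bddAbove j).trans
    (le_ciSup (f := fun i => ⨆ j, (a i + w i - a j)) (Set.finite_range _).bddAbove i)

theorem pval_le {n : ℕ} [Nonempty (Fin n)] {w a : Fin n → ℝ} {c : ℝ}
    (h : ∀ i j, a i + w i - a j ≤ c) : pval w a ≤ c :=
  ciSup_le fun i => ciSup_le (h i)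

theorem qval_nonneg {n : ℕ} {l : Fin n → ℝ} (hl : ∀ i, 0 ≤ l i) (b : Fin n → ℝ) :
    0 ≤ qval l b := by
  rcases isEmpty_or_nonempty (Fin n) with h | ⟨⟨i⟩⟩
  · simp [qval]
  · calc 0 ≤ b i + l i - b i := by simpa using hl i
      _ ≤ qval l b := le_pval l b i i

/-- Lemma 1(ii), extension: extending the width of the first rectangle by
`Δx` and shifting every rectangle lying to its right by `Δx` yields a positioning, with
`T(W) ≤ T(M) + q(M)·Δx`. -/
theorem extension_bound {n : ℕ} (w l : Fin (n + 1) → ℝ)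
    (hw : ∀ i, 0 < w i) (hl : ∀ i, 0 < l i)
    (a b : Fin (n + 1) → ℝ) (hM : IsPositioning w l a b)
    (Δx : ℝ) (hΔx : 0 < Δx) :
    IsPositioning (Function.update w 0 (w 0 + Δx)) l
      (fun k => if k = 0 then a 0 else if a 0 + w 0 ≤ a k then a k + Δx else a k) b ∧
    Tval (Function.update w 0 (w 0 + Δx)) l
      (fun k => if k = 0 then a 0 else if a 0 + w 0 ≤ a k then a k + Δx else a k) b
      ≤ Tval w l a b + qval l b * Δx := by
  constructor
  · have hw' : ∀ i, 0 < Function.update w 0 (w 0 + Δx) i := by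
      intro i
      have := hw i
      have := hw 0
      rw [Function.update_apply]
      split_ifs <;> linarith
    rw [isPositioning_iff hw hl] at hM
    rw [isPositioning_iff hw' hl]
    intro i j hij
    have := hM i j hij
    have := hw i
    have := hw j
    have := hw 0
    simp only [Function.update_apply]
    grind
  · rw [Tval, Tval, mul_comm (qval l b), ← add_mul]
    refine mul_le_mul_of_nonneg_right (pval_le fun i j => ?_) (qval_nonneg (fun i => (hl i).le) b)
    have := le_pval w a i j
    have := hw 0
    simp only [Function.update_apply]
    grind
end

section
/- (Double extension; Lemma 1(iii)) Let M be a positioning of a finite family A of rectangles, let Δx > 0 and Δy > 0. Let W be the positioning obtained from M by an x-extension of rectangle 1 by Δx (replace w₁ by w₁ + Δx; shift rectangle k by Δx in the x-direction whenever aₖ ≥ a₁ + w₁), and let V be the positioning obtained from W by the analogous y-extension of rectangle 1 by Δy (replace l₁ by l₁ + Δy; shift rectangle k by Δy in the y-direction whenever bₖ ≥ b₁ + l₁). Then V is a positioning of the family A″ obtained from A by replacing w₁, l₁ with w₁ + Δx, l₁ + Δy, and T(V) ≤ T(M) + q(M)·Δx + p(M)·Δy + Δx·Δy. -/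
open Set Finset Function

/-- Rectangles with positive sides have disjoint interiors exactly when they are separated
along one of the two axes. -/
theorem isPositioning_iff_separated {ι : Type*} {w l : ι → ℝ} (hw : ∀ i, 0 < w i)
    (hl : ∀ i, 0 < l i) (a b : ι → ℝ) :
    IsPositioning w l a b ↔ ∀ i j, i ≠ j →
      (a i + w i ≤ a j ∨ a j + w j ≤ a i) ∨ (b i + l i ≤ b j ∨ b j + l j ≤ b i) := by
  refine forall_congr' fun i => forall_congr' fun j => forall_congr' fun _ => ?_
  have h₁ := hw i
  have h₂ := hw j
  have h₃ := hl i
  have h₄ := hl j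
  rw [Set.disjoint_prod, Set.Ioo_disjoint_Ioo, Set.Ioo_disjoint_Ioo]
  simp only [min_le_iff, le_max_iff]
  grind

/-- Corner coordinates after extending rectangle `0` by `d` along one axis. -/
noncomputable def extendCoord {n : ℕ} (w a : Fin (n + 1) → ℝ) (d : ℝ) : Fin (n + 1) → ℝ :=
  fun k => if k = 0 then a 0 else if a 0 + w 0 ≤ a k then a k + d else a k

theorem update_add_pos {n : ℕ} {w : Fin (n + 1) → ℝ} (hw : ∀ i, 0 < w i) {d : ℝ} (hd : 0 < d)
    (i : Fin (n + 1)) : 0 < Function.update w 0 (w 0 + d) i := by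
  have h₀ := hw 0
  have h := hw i
  simp only [Function.update_apply]
  split_ifs <;> linarith

/-- An extension preserves the order of two rectangles separated along its axis. -/
theorem extendCoord_separated {n : ℕ} {w : Fin (n + 1) → ℝ} (hw : ∀ i, 0 < w i)
    (a : Fin (n + 1) → ℝ) {d : ℝ} (hd : 0 < d) {i j : Fin (n + 1)} (hij : i ≠ j)
    (h : a i + w i ≤ a j) :
    extendCoord w a d i + Function.update w 0 (w 0 + d) i ≤ extendCoord w a d j := by
  have h₀ := hw 0
  have h₁ := hw i
  simp only [extendCoord, Function.update_apply]
  grind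

theorem pval_pos {n : ℕ} {w : Fin (n + 1) → ℝ} (hw : ∀ i, 0 < w i) (a : Fin (n + 1) → ℝ) :
    0 < pval w a := by
  linarith [le_pval w a 0 0, hw 0]

theorem pval_extendCoord_le {n : ℕ} (w a : Fin (n + 1) → ℝ) {d : ℝ} (hd : 0 < d) :
    pval (Function.update w 0 (w 0 + d)) (extendCoord w a d) ≤ pval w a + d := by
  refine ciSup_le fun i => ciSup_le fun j => ?_
  have h := le_pval w a i j
  simp only [extendCoord, Function.update_apply]
  grind

/-- Lemma 1(iii), double extension: extending the first rectangle by `Δx`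
horizontally and then by `Δy` vertically (shifting the appropriate rectangles) yields a
positioning with `T(V) ≤ T(M) + q(M)·Δx + p(M)·Δy + Δx·Δy`. -/
theorem double_extension_bound {n : ℕ} (w l : Fin (n + 1) → ℝ)
    (hw : ∀ i, 0 < w i) (hl : ∀ i, 0 < l i)
    (a b : Fin (n + 1) → ℝ) (hM : IsPositioning w l a b)
    (Δx Δy : ℝ) (hΔx : 0 < Δx) (hΔy : 0 < Δy) :
    IsPositioning (Function.update w 0 (w 0 + Δx)) (Function.update l 0 (l 0 + Δy))
      (fun k => if k = 0 then a 0 else if a 0 + w 0 ≤ a k then a k + Δx else a k)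
      (fun k => if k = 0 then b 0 else if b 0 + l 0 ≤ b k then b k + Δy else b k) ∧
    Tval (Function.update w 0 (w 0 + Δx)) (Function.update l 0 (l 0 + Δy))
      (fun k => if k = 0 then a 0 else if a 0 + w 0 ≤ a k then a k + Δx else a k)
      (fun k => if k = 0 then b 0 else if b 0 + l 0 ≤ b k then b k + Δy else b k)
      ≤ Tval w l a b + qval l b * Δx + pval w a * Δy + Δx * Δy := by
  have hw' := update_add_pos hw hΔx
  have hl' := update_add_pos hl hΔy
  constructor
  · refine (isPositioning_iff_separated hw' hl' (extendCoord w a Δx) (extendCoord l b Δy)).2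
      fun i j hij => ?_
    exact ((isPositioning_iff_separated hw hl a b).1 hM i j hij).imp
      (Or.imp (extendCoord_separated hw a hΔx hij) (extendCoord_separated hw a hΔx hij.symm))
      (Or.imp (extendCoord_separated hl b hΔy hij) (extendCoord_separated hl b hΔy hij.symm))
  · have hp := pval_pos hw a
    have hq : 0 < qval (Function.update l 0 (l 0 + Δy)) (extendCoord l b Δy) := pval_pos hl' _
    have hqle : qval (Function.update l 0 (l 0 + Δy)) (extendCoord l b Δy) ≤ qval l b + Δy :=
      pval_extendCoord_le l b hΔy
    calc
      _ ≤ (pval w a + Δx) * (qval l b + Δy) :=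
        mul_le_mul (pval_extendCoord_le w a hΔx) hqle hq.le (by linarith)
      _ = _ := by
        unfold Tval
        ring
end

section
/- (Lemma 2, height version) Let A be a finite family of n rectangles with widths wᵢ and heights lᵢ, let ΔA = (Δw₁, Δl₁, …, Δwₙ, Δlₙ) be such that A′ = A + ΔA has all sides positive, and let M be any positioning of A′ attaining the best packing efficiency, i.e. η(M) = η₀(A′) (equivalently T(M) = T₀(A′)). Then q(M) ≤ Σᵢ lᵢ + Σᵢ |Δlᵢ|. -/
open Set Finset Function

/-- Intervals can be shifted so that they stay in the same order and span at most
the sum of their lengths. -/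
theorem exists_compression {ι : Type*} [Fintype ι] (l b : ι → ℝ) (hl : ∀ i, 0 < l i) :
    ∃ c : ι → ℝ, (∀ i j, b i + l i ≤ b j → c i + l i ≤ c j) ∧
      ∀ i j, c i + l i - c j ≤ ∑ k, l k := by
  set U : Set ℝ := ⋃ i, Set.Ioo (b i) (b i + l i)
  have hvol : MeasureTheory.volume.real U ≤ ∑ k, l k := by
    refine (MeasureTheory.measureReal_iUnion_fintype_le _).trans
      (Finset.sum_le_sum fun i _ => ?_)
    rw [Real.volume_real_Ioo_of_le (by linarith [hl i])]
    linarith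
  have hfin : MeasureTheory.volume U ≠ ⊤ := by
    refine ((MeasureTheory.measure_iUnion_fintype_le _ _).trans_lt ?_).ne
    exact ENNReal.sum_lt_top.2 fun i _ => measure_Ioo_lt_top
  have hstep : ∀ i, MeasureTheory.volume.real (U ∩ Set.Iio (b i)) + l i ≤
      MeasureTheory.volume.real (U ∩ Set.Iio (b i + l i)) := by
    intro i
    have hd : Disjoint (U ∩ Set.Iio (b i)) (Set.Ioo (b i) (b i + l i)) :=
      Set.disjoint_left.2 fun x hx hy => lt_asymm hx.2 hy.1
    have hlen : MeasureTheory.volume.real (Set.Ioo (b i) (b i + l i)) = l i := by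
      rw [Real.volume_real_Ioo_of_le (by linarith [hl i])]
      ring
    have hadd := MeasureTheory.measureReal_union (μ := MeasureTheory.volume) hd
      measurableSet_Ioo (MeasureTheory.measure_ne_top_of_subset Set.inter_subset_left hfin)
      measure_Ioo_lt_top.ne
    rw [hlen] at hadd
    rw [← hadd]
    refine MeasureTheory.measureReal_mono ?_
      (MeasureTheory.measure_ne_top_of_subset Set.inter_subset_left hfin)
    rintro x (hx | hx)
    · exact ⟨hx.1, lt_trans hx.2 (lt_add_of_pos_right _ (hl i))⟩
    · exact ⟨Set.mem_iUnion.2 ⟨i, hx⟩, hx.2⟩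
  refine ⟨fun i => MeasureTheory.volume.real (U ∩ Set.Iio (b i)), fun i j hij => ?_,
    fun i j => ?_⟩
  · exact (hstep i).trans (MeasureTheory.measureReal_mono
      (Set.inter_subset_inter_right _ (Set.Iio_subset_Iio hij))
      (MeasureTheory.measure_ne_top_of_subset Set.inter_subset_left hfin))
  · have hle : MeasureTheory.volume.real (U ∩ Set.Iio (b i + l i)) ≤
        MeasureTheory.volume.real U :=
      MeasureTheory.measureReal_mono Set.inter_subset_left hfin
    have hnonneg : 0 ≤ MeasureTheory.volume.real (U ∩ Set.Iio (b j)) :=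
      MeasureTheory.measureReal_nonneg
    linarith [hstep i]

theorem IsPositioning.of_order_preserving {ι : Type*} {w l a b c : ι → ℝ}
    (hl : ∀ i, 0 < l i) (h : IsPositioning w l a b)
    (hc : ∀ i j, b i + l i ≤ b j → c i + l i ≤ c j) : IsPositioning w l a c := by
  intro i j hij
  refine Set.disjoint_prod.2 ((Set.disjoint_prod.1 (h i j hij)).imp_right fun hd => ?_)
  rw [Set.Ioo_disjoint_Ioo] at hd ⊢
  have hi := hl i
  have hj := hl j
  rcases min_le_iff.1 hd with hd | hd <;> rcases le_max_iff.1 hd with hd | hd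
  · linarith
  · exact (min_le_left _ _).trans ((hc i j hd).trans (le_max_right _ _))
  · exact (min_le_right _ _).trans ((hc j i hd).trans (le_max_left _ _))
  · linarith

theorem le_qval {n : ℕ} (l b : Fin n → ℝ) (i : Fin n) : l i ≤ qval l b := by
  have h := (le_ciSup (Set.finite_range fun j => b i + l i - b j).bddAbove i).trans
    (le_ciSup (Set.finite_range fun i => ⨆ j, (b i + l i - b j)).bddAbove i)
  simpa [qval] using h

theorem le_Tval {n : ℕ} {w l : Fin n → ℝ} (hw : ∀ i, 0 < w i) (hl : ∀ i, 0 < l i)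
    (a b : Fin n → ℝ) (i : Fin n) : w i * l i ≤ Tval w l a b :=
  mul_le_mul (le_qval w a i) (le_qval l b i) (hl i).le ((hw i).le.trans (le_qval w a i))

theorem eta_le_eta0 {n : ℕ} {w l a b : Fin (n + 1) → ℝ} (hw : ∀ i, 0 < w i)
    (hl : ∀ i, 0 < l i) (h : IsPositioning w l a b) : eta w l a b ≤ eta0 w l := by
  refine le_csSup ⟨Sval w l / (w 0 * l 0), ?_⟩ ⟨a, b, h, rfl⟩
  rintro _ ⟨a', b', -, rfl⟩
  exact div_le_div_of_nonneg_left (Finset.sum_nonneg fun i _ => (mul_pos (hw i) (hl i)).le)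
    (mul_pos (hw 0) (hl 0)) (le_Tval hw hl a' b' 0)

/-- A positioning of best packing efficiency has height at most the total height. -/
theorem qval_le_sum_of_eta_eq_eta0 {n : ℕ} {w l a b : Fin (n + 1) → ℝ} (hw : ∀ i, 0 < w i)
    (hl : ∀ i, 0 < l i) (h : IsPositioning w l a b) (hopt : eta w l a b = eta0 w l) :
    qval l b ≤ ∑ i, l i := by
  obtain ⟨c, hc, hsum⟩ := exists_compression l b hl
  have hle : eta w l a c ≤ eta w l a b :=
    (eta_le_eta0 hw hl (h.of_order_preserving hl hc)).trans hopt.ge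
  have hS : 0 < Sval w l :=
    Finset.sum_pos (fun i _ => mul_pos (hw i) (hl i)) Finset.univ_nonempty
  have hT : ∀ b', 0 < Tval w l a b' := fun b' =>
    (mul_pos (hw 0) (hl 0)).trans_le (le_Tval hw hl a b' 0)
  have hTle : Tval w l a b ≤ Tval w l a c :=
    (div_le_div_iff_of_pos_left hS (hT c) (hT b)).1 hle
  have hp : 0 < pval w a := (hw 0).trans_le (le_qval w a 0)
  exact (le_of_mul_le_mul_left hTle hp).trans (ciSup_le fun i => ciSup_le fun j => hsum i j)

/-- Lemma 2, height version: any positioning of the perturbed family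
`A' = A + ΔA` attaining the best packing efficiency has vertical extent at most
`∑ lᵢ + ∑ |Δlᵢ|`. -/
theorem optimal_q_bound {n : ℕ} (w l Δw Δl : Fin (n + 1) → ℝ)
    (hw : ∀ i, 0 < w i) (hl : ∀ i, 0 < l i)
    (hw' : ∀ i, 0 < w i + Δw i) (hl' : ∀ i, 0 < l i + Δl i)
    (a b : Fin (n + 1) → ℝ)
    (hM : IsPositioning (fun i => w i + Δw i) (fun i => l i + Δl i) a b)
    (hopt : eta (fun i => w i + Δw i) (fun i => l i + Δl i) a b
      = eta0 (fun i => w i + Δw i) (fun i => l i + Δl i)) :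
    qval (fun i => l i + Δl i) b ≤ (∑ i, l i) + ∑ i, |Δl i| := by
  refine (qval_le_sum_of_eta_eq_eta0 hw' hl' hM hopt).trans ?_
  rw [← Finset.sum_add_distrib]
  exact Finset.sum_le_sum fun i _ => by linarith [le_abs_self (Δl i)]
end

section
/- (Case (I) estimate in the proof of Lemma 3) Let A be a finite family of n rectangles, M₀ a positioning of A with T(M₀) = T₀(A), and let ΔA = (Δw₁, Δl₁, …, Δwₙ, Δlₙ) be such that A′ = A + ΔA has all sides positive. If T₀(A′) ≥ T₀(A), then T₀(A′) − T₀(A) ≤ q(M₀)·Σₖ|Δwₖ| + p(M₀)·Σₖ|Δlₖ| + (Σₖ|Δwₖ|)·(Σₖ|Δlₖ|). -/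
open Set Finset Function

theorem pval_nonneg {n : ℕ} {w : Fin (n + 1) → ℝ} (hw : ∀ i, 0 < w i) (a : Fin (n + 1) → ℝ) :
    0 ≤ pval w a := by
  linarith [le_pval w a 0 0, hw 0]

theorem Tval_nonneg {n : ℕ} {w l : Fin (n + 1) → ℝ} (hw : ∀ i, 0 < w i) (hl : ∀ i, 0 < l i)
    (a b : Fin (n + 1) → ℝ) : 0 ≤ Tval w l a b :=
  mul_nonneg (pval_nonneg hw a) (pval_nonneg hl b)

theorem T0_le_Tval {n : ℕ} {w l : Fin (n + 1) → ℝ} (hw : ∀ i, 0 < w i) (hl : ∀ i, 0 < l i)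
    {a b : Fin (n + 1) → ℝ} (h : IsPositioning w l a b) : T0 w l ≤ Tval w l a b := by
  refine csInf_le ⟨0, ?_⟩ ⟨a, b, h, rfl⟩
  rintro t ⟨a, b, -, rfl⟩
  exact Tval_nonneg hw hl a b

/-- Shift each left endpoint to the right by the total length change of the intervals that
end at or before it. -/
noncomputable def spread {n : ℕ} (w Δw a : Fin n → ℝ) (i : Fin n) : ℝ :=
  a i + ∑ k with a k + w k ≤ a i, |Δw k|

theorem spread_separated {n : ℕ} {w : Fin n → ℝ} (hw : ∀ i, 0 < w i) (Δw a : Fin n → ℝ)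
    {i j : Fin n} (h : a i + w i ≤ a j) :
    spread w Δw a i + (w i + Δw i) ≤ spread w Δw a j := by
  have hi : i ∉ ({k | a k + w k ≤ a i} : Finset (Fin n)) := by simpa using hw i
  have hsub : Finset.cons i _ hi ⊆ ({k | a k + w k ≤ a j} : Finset (Fin n)) := by
    intro k hk
    simp only [Finset.mem_cons, Finset.mem_filter_univ] at hk ⊢
    rcases hk with rfl | hk
    · exact h
    · linarith [hw i]
  have hsum := Finset.sum_le_sum_of_subset_of_nonneg hsub
    (f := fun k => |Δw k|) (fun k _ _ => abs_nonneg _)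
  rw [Finset.sum_cons] at hsum
  unfold spread
  linarith [le_abs_self (Δw i)]

theorem pval_spread_le {n : ℕ} {w : Fin (n + 1) → ℝ} (hw : ∀ i, 0 < w i)
    (Δw a : Fin (n + 1) → ℝ) :
    pval (fun i => w i + Δw i) (spread w Δw a) ≤ pval w a + ∑ k, |Δw k| := by
  refine ciSup_le fun i => ciSup_le fun j => ?_
  have hi : i ∉ ({k | a k + w k ≤ a i} : Finset (Fin (n + 1))) := by simpa using hw i
  have hsum := Finset.sum_le_sum_of_subset_of_nonneg (Finset.subset_univ (Finset.cons i _ hi))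
    (f := fun k => |Δw k|) (fun k _ _ => abs_nonneg _)
  rw [Finset.sum_cons] at hsum
  have hj : 0 ≤ ∑ k with a k + w k ≤ a j, |Δw k| := Finset.sum_nonneg fun k _ => abs_nonneg _
  unfold spread
  linarith [le_abs_self (Δw i), le_pval w a i j]

theorem disjoint_Ioo_spread {n : ℕ} {w Δw : Fin n → ℝ} (hw : ∀ i, 0 < w i)
    (hw' : ∀ i, 0 < w i + Δw i) {a : Fin n → ℝ} {i j : Fin n}
    (h : Disjoint (Set.Ioo (a i) (a i + w i)) (Set.Ioo (a j) (a j + w j))) :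
    Disjoint (Set.Ioo (spread w Δw a i) (spread w Δw a i + (w i + Δw i)))
      (Set.Ioo (spread w Δw a j) (spread w Δw a j + (w j + Δw j))) := by
  rw [disjoint_Ioo_add_iff (hw i) (hw j)] at h
  rw [disjoint_Ioo_add_iff (hw' i) (hw' j)]
  exact h.imp (spread_separated hw Δw a) (spread_separated hw Δw a)

theorem IsPositioning.spread {n : ℕ} {w l Δw Δl : Fin n → ℝ}
    (hw : ∀ i, 0 < w i) (hl : ∀ i, 0 < l i)
    (hw' : ∀ i, 0 < w i + Δw i) (hl' : ∀ i, 0 < l i + Δl i)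
    {a b : Fin n → ℝ} (h : IsPositioning w l a b) :
    IsPositioning (fun i => w i + Δw i) (fun i => l i + Δl i)
      (spread w Δw a) (spread l Δl b) := fun i j hij =>
  Set.disjoint_prod.2 <| (Set.disjoint_prod.1 (h i j hij)).imp
    (disjoint_Ioo_spread hw hw') (disjoint_Ioo_spread hl hl')

/-- Case (I) estimate in the proof of Lemma 3: if the perturbed family has
larger minimal bounding area, the increase is controlled by the extents of an optimal
positioning of `A` and by `∑|Δw|`, `∑|Δl|`. -/
theorem T0_increase_estimate {n : ℕ} (w l Δw Δl : Fin (n + 1) → ℝ)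
    (hw : ∀ i, 0 < w i) (hl : ∀ i, 0 < l i)
    (hw' : ∀ i, 0 < w i + Δw i) (hl' : ∀ i, 0 < l i + Δl i)
    (a₀ b₀ : Fin (n + 1) → ℝ) (hM₀ : IsPositioning w l a₀ b₀)
    (hopt : Tval w l a₀ b₀ = T0 w l)
    (hge : T0 w l ≤ T0 (fun i => w i + Δw i) (fun i => l i + Δl i)) :
    T0 (fun i => w i + Δw i) (fun i => l i + Δl i) - T0 w l
      ≤ qval l b₀ * (∑ k, |Δw k|) + pval w a₀ * (∑ k, |Δl k|)
        + (∑ k, |Δw k|) * (∑ k, |Δl k|) := by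
  have hT := T0_le_Tval hw' hl' (hM₀.spread hw hl hw' hl')
  have hmul : Tval (fun i => w i + Δw i) (fun i => l i + Δl i) (spread w Δw a₀) (spread l Δl b₀)
      ≤ (pval w a₀ + ∑ k, |Δw k|) * (qval l b₀ + ∑ k, |Δl k|) :=
    mul_le_mul (pval_spread_le hw Δw a₀) (pval_spread_le hl Δl b₀) (pval_nonneg hl' _)
      (add_nonneg (pval_nonneg hw a₀) (Finset.sum_nonneg fun k _ => abs_nonneg _))
  rw [← hopt]
  unfold Tval at hmul hT ⊢
  linarith
end

section
/- (Well-definedness in Theorem 2) Let A be a countably infinite family of rectangles with widths wᵢ > 0 and heights lᵢ > 0 satisfying (C1) Σᵢ lᵢ² < ∞ and (C2) wᵢ ≤ lᵢ and lᵢ₊₁ ≤ lᵢ for all i. Then there exists a positioning of the whole infinite family A with finite bounding area; in particular T₀(A) = inf over positionings M of A of T(M) is a well-defined finite real number, and η₀(A) = S(A)/T₀(A) is well-defined. -/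
open Set Finset Function

/-- Minimal bounding area of a countably infinite family of rectangles:
the infimum of `P * Q` over all positionings that fit within horizontal extent `P`
and vertical extent `Q`. -/
noncomputable def T0inf (w l : ℕ → ℝ) : ℝ :=
  sInf {t | ∃ a b : ℕ → ℝ, ∃ P Q : ℝ, IsPositioning w l a b ∧
    (∀ i j, a i + w i - a j ≤ P) ∧ (∀ i j, b i + l i - b j ≤ Q) ∧ t = P * Q}

/-- Two open boxes with separated horizontal or vertical sides are disjoint. -/
lemma disjoint_Ioo_prod_of_separated {x x' u u' y y' v v' : ℝ}
    (h : (x + u ≤ x' ∨ x' + u' ≤ x) ∨ (y + v ≤ y' ∨ y' + v' ≤ y)) :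
    Disjoint (Set.Ioo x (x + u) ×ˢ Set.Ioo y (y + v))
      (Set.Ioo x' (x' + u') ×ˢ Set.Ioo y' (y' + v')) := by
  rw [Set.disjoint_left]
  rintro ⟨s, t⟩ ⟨⟨h1, h2⟩, h3, h4⟩ ⟨⟨h5, h6⟩, h7, h8⟩
  dsimp only at *
  rcases h with (h | h) | h | h <;> linarith

/-- Distinct cells of a grid with spacing `d` are separated in one of the two directions. -/
lemma grid_cells_separated {d : ℝ} (hd : 0 ≤ d) {m n c : ℕ} (hmn : m ≠ n) :
    ((m % c : ℕ) * d + d ≤ (n % c : ℕ) * d ∨ (n % c : ℕ) * d + d ≤ (m % c : ℕ) * d) ∨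
      ((m / c : ℕ) * d + d ≤ (n / c : ℕ) * d ∨ (n / c : ℕ) * d + d ≤ (m / c : ℕ) * d) := by
  have key : ∀ {p q : ℕ}, p < q → (p : ℝ) * d + d ≤ q * d := by
    intro p q hpq
    have : ((p : ℝ) + 1) ≤ q := by exact_mod_cast hpq
    nlinarith
  rcases lt_trichotomy (m % c) (n % c) with h | h | h
  · exact .inl (.inl (key h))
  · rcases lt_trichotomy (m / c) (n / c) with h' | h' | h'
    · exact .inr (.inl (key h'))
    · exact absurd (by rw [← Nat.div_add_mod m c, ← Nat.div_add_mod n c, h, h']) hmn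
    · exact .inr (.inr (key h'))
  · exact .inl (.inr (key h))

lemma summable_condensed_sq {l : ℕ → ℝ} (hl : ∀ i, 0 < l i)
    (hs : Summable fun i => l i ^ 2) (hmono : Antitone l) :
    Summable fun k : ℕ => (2 : ℝ) ^ k * l (2 ^ k - 1) ^ 2 := by
  refine (summable_condensed_iff_of_nonneg (f := fun n => l (n - 1) ^ 2)
    (fun n => sq_nonneg _) ?_).2 ((summable_nat_add_iff 1).1 (by simpa using hs))
  intro m n _ hmn
  exact pow_le_pow_left₀ (hl _).le (hmono (by lia)) 2

lemma summable_condensed {l : ℕ → ℝ} (hl : ∀ i, 0 < l i)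
    (hs : Summable fun i => l i ^ 2) (hmono : Antitone l) :
    Summable fun k : ℕ => l (2 ^ k - 1) := by
  refine Summable.of_nonneg_of_le (fun k => (hl _).le) (fun k => ?_)
    ((summable_condensed_sq hl hs hmono).add summable_geometric_two)
  have h2 : (0 : ℝ) < 2 ^ k := by positivity
  have h : (2 : ℝ) ^ k * l (2 ^ k - 1) ^ 2 + (1 / 2) ^ k - l (2 ^ k - 1)
      = ((2 ^ k * l (2 ^ k - 1) - 1 / 2) ^ 2 + 3 / 4) / 2 ^ k := by
    rw [one_div, inv_pow]
    field_simp
    ring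
  have : 0 ≤ ((2 ^ k * l (2 ^ k - 1) - 1 / 2) ^ 2 + 3 / 4) / 2 ^ k := by positivity
  linarith

/-- The slab of `n` squares of side `d` in rows of width at most `L` has height at most
`2 n d² / L + d`. -/
lemma slab_height_le {d L : ℝ} (hd : 0 < d) (hdL : d ≤ L) (n : ℕ) :
    ((n / ⌊L / d⌋₊ + 1 : ℕ) : ℝ) * d ≤ 2 / L * (n * d ^ 2) + d := by
  have hL : 0 < L := hd.trans_le hdL
  have hc : 1 ≤ ⌊L / d⌋₊ := Nat.one_le_floor_iff _ |>.2 ((one_le_div hd).2 hdL)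
  have hc' : (1 : ℝ) ≤ ⌊L / d⌋₊ := by exact_mod_cast hc
  have h1 : L / d < ⌊L / d⌋₊ + 1 := Nat.lt_floor_add_one _
  have h2 : L ≤ 2 * ⌊L / d⌋₊ * d := by
    rw [div_lt_iff₀ hd] at h1
    nlinarith
  have h3 : ((n / ⌊L / d⌋₊ : ℕ) : ℝ) ≤ 2 / L * (n * d) := by
    refine Nat.cast_div_le.trans ?_
    rw [div_le_iff₀ (by linarith), div_mul_eq_mul_div, div_mul_eq_mul_div, le_div_iff₀ hL]
    have := mul_le_mul_of_nonneg_left h2 (Nat.cast_nonneg (α := ℝ) n)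
    linarith
  push_cast
  nlinarith [mul_le_mul_of_nonneg_right h3 hd.le]

/-- A family of rectangles no wider than tall, with antitone heights whose squares are summable,
can be packed in a bounded box. -/
lemma exists_bounded_positioning {w l : ℕ → ℝ} (hl : ∀ i, 0 < l i)
    (hs : Summable fun i => l i ^ 2) (hwl : ∀ i, w i ≤ l i) (hmono : Antitone l) :
    ∃ a b : ℕ → ℝ, ∃ P Q : ℝ, IsPositioning w l a b ∧
      (∀ i j, a i + w i - a j ≤ P) ∧ (∀ i j, b i + l i - b j ≤ Q) := by
  let d : ℕ → ℝ := fun k => l (2 ^ k - 1)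
  let c : ℕ → ℕ := fun k => ⌊l 0 / d k⌋₊
  let h : ℕ → ℝ := fun k => ((2 ^ k / c k + 1 : ℕ) : ℝ) * d k
  let H : ℕ → ℝ := fun k => ∑ j ∈ Finset.range k, h j
  let κ : ℕ → ℕ := fun i => Nat.log 2 (i + 1)
  let r : ℕ → ℕ := fun i => i + 1 - 2 ^ κ i
  have hd : ∀ k, 0 < d k := fun k => hl _
  have hd0 : ∀ k, d k ≤ l 0 := fun k => hmono (Nat.zero_le _)
  have hc : ∀ k, 0 < c k := fun k => Nat.floor_pos.2 ((one_le_div (hd k)).2 (hd0 k))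
  have hcd : ∀ k, c k * d k ≤ l 0 := fun k =>
    (le_div_iff₀ (hd k)).1 (Nat.floor_le (div_pos (hl 0) (hd k)).le)
  have hh : ∀ k, 0 ≤ h k := fun k => mul_nonneg (Nat.cast_nonneg _) (hd k).le
  have hsum : Summable h := by
    refine Summable.of_nonneg_of_le hh (fun k => ?_)
      (((summable_condensed_sq hl hs hmono).mul_left (2 / l 0)).add
        (summable_condensed hl hs hmono))
    simpa [h, c, d] using slab_height_le (hd k) (hd0 k) (2 ^ k)
  have hHmono : Monotone H := fun m n hmn =>
    Finset.sum_le_sum_of_subset_of_nonneg (Finset.range_mono hmn) fun j _ _ => hh j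
  have hHnonneg : ∀ k, 0 ≤ H k := fun k => Finset.sum_nonneg fun j _ => hh j
  have hpow : ∀ i, 2 ^ κ i ≤ i + 1 := fun i => Nat.pow_log_le_self 2 (by lia)
  have hr : ∀ i, r i < 2 ^ κ i := by
    intro i
    have := Nat.lt_pow_succ_log_self (b := 2) one_lt_two (i + 1)
    have := hpow i
    simp only [r, κ, pow_succ] at *
    lia
  have hld : ∀ i, l i ≤ d (κ i) := fun i => hmono (by have := hpow i; lia)
  let a : ℕ → ℝ := fun i => (r i % c (κ i) : ℕ) * d (κ i)
  let b : ℕ → ℝ := fun i => H (κ i) + (r i / c (κ i) : ℕ) * d (κ i)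
  have ha : ∀ i, 0 ≤ a i := fun i => mul_nonneg (Nat.cast_nonneg _) (hd _).le
  have hb : ∀ i, H (κ i) ≤ b i := fun i =>
    le_add_of_nonneg_right (mul_nonneg (Nat.cast_nonneg _) (hd _).le)
  have ha' : ∀ i, a i + w i ≤ l 0 := by
    intro i
    have h1 : ((r i % c (κ i) : ℕ) : ℝ) + 1 ≤ c (κ i) := by
      exact_mod_cast Nat.mod_lt (r i) (hc (κ i))
    have h2 := mul_le_mul_of_nonneg_right h1 (hd (κ i)).le
    have := hwl i
    have := hld i
    have := hcd (κ i)
    simp only [a]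
    linarith
  have hb' : ∀ i, b i + l i ≤ H (κ i + 1) := by
    intro i
    have h1 : ((r i / c (κ i) : ℕ) : ℝ) + 1 ≤ (2 ^ κ i / c (κ i) + 1 : ℕ) := by
      exact_mod_cast Nat.succ_le_succ (Nat.div_le_div_right (hr i).le)
    have h2 := mul_le_mul_of_nonneg_right h1 (hd (κ i)).le
    have := hld i
    simp only [b, H, Finset.sum_range_succ, h] at *
    linarith
  refine ⟨a, b, l 0, ∑' k, h k, fun i j hij => ?_, fun i j => ?_, fun i j => ?_⟩
  · apply disjoint_Ioo_prod_of_separated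
    rcases lt_trichotomy (κ i) (κ j) with hk | hk | hk
    · exact .inr (.inl ((hb' i).trans ((hHmono hk).trans (hb j))))
    · have hrij : r i ≠ r j := by
        have := hpow i
        have := hpow j
        simp only [r, ← hk] at *
        lia
      have hi := hld i
      have hj := hld j
      have hwi := hwl i
      have hwj := hwl j
      rw [← hk] at hj
      simp only [a, b, ← hk]
      rcases grid_cells_separated (c := c (κ i)) (hd (κ i)).le hrij with (h | h) | h | h
      · exact .inl (.inl (by linarith))
      · exact .inl (.inr (by linarith))
      · exact .inr (.inl (by linarith))
      · exact .inr (.inr (by linarith))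
    · exact .inr (.inr ((hb' j).trans ((hHmono hk).trans (hb i))))
  · linarith [ha' i, ha j]
  · have := hsum.sum_le_tsum (Finset.range (κ i + 1)) fun k _ => hh k
    linarith [hb' i, hHnonneg (κ j), hb j]

/-- Well-definedness in Theorem 2: under (C1) and (C2) the infinite family
admits a positioning with finite bounding area; in particular `T₀(A)` is a well-defined
positive real number (so `η₀(A) = S(A)/T₀(A)` is well-defined). -/
theorem T0inf_well_defined (w l : ℕ → ℝ)
    (hw : ∀ i, 0 < w i) (hl : ∀ i, 0 < l i)
    (hC1 : Summable fun i => l i ^ 2)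
    (hC2 : ∀ i, w i ≤ l i) (hC2' : ∀ i, l (i + 1) ≤ l i) :
    (∃ a b : ℕ → ℝ, ∃ P Q : ℝ, IsPositioning w l a b ∧
      (∀ i j, a i + w i - a j ≤ P) ∧ (∀ i j, b i + l i - b j ≤ Q)) ∧
    0 < T0inf w l := by
  have hex := exists_bounded_positioning hl hC1 hC2 (antitone_nat_of_succ_le hC2')
  refine ⟨hex, (mul_pos (hw 0) (hl 0)).trans_le (le_csInf ?_ ?_)⟩
  · obtain ⟨a, b, P, Q, hpos, hP, hQ⟩ := hex
    exact ⟨P * Q, a, b, P, Q, hpos, hP, hQ, rfl⟩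
  · rintro t ⟨a, b, P, Q, -, hP, hQ, rfl⟩
    have hwP : w 0 ≤ P := by simpa using hP 0 0
    have hlQ : l 0 ≤ Q := by simpa using hQ 0 0
    exact mul_le_mul hwP hlQ (hl 0).le ((hw 0).le.trans hwP)
end

section
/- (Quantitative step in Theorem 2) Let A be a countably infinite family of rectangles with widths wᵢ > 0 and heights lᵢ > 0 satisfying (C1) Σᵢ lᵢ² < ∞ and (C2) wᵢ ≤ lᵢ and lᵢ₊₁ ≤ lᵢ for all i. Let Aⁿ be the finite family of the first n rectangles and Rₙ = Σ_{k=n+1}^∞ lₖ². Then for all sufficiently large n (namely whenever 4√Rₙ ≤ q(M) for an optimal positioning M of Aⁿ), T₀(A) − T₀(Aⁿ) ≤ T₀(Aⁿ)·√Rₙ / w₁. -/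
open Set Finset Function

/-- Next-fit shelf packing of squares of sides `d i` in a vertical strip of width `s`:
the triple at `i` is the abscissa of square `i`, the ordinate of its shelf, and the ordinate of
the top of that shelf. -/
noncomputable def shelfPacking (s : ℝ) (d : ℕ → ℝ) : ℕ → ℝ × ℝ × ℝ
  | 0 => (0, 0, d 0)
  | i + 1 =>
    let t := shelfPacking s d i
    if t.1 + d i + d (i + 1) ≤ s then (t.1 + d i, t.2.1, t.2.2)
    else (0, t.2.2, t.2.2 + d (i + 1))

/-- Squares with decreasing sides and total area at most `s ^ 2` can be packed in a strip of
width `s` and height `3 * s`. -/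
theorem exists_square_packing {s : ℝ} {d : ℕ → ℝ} (hs : 0 < s) (hd : ∀ i, 0 < d i)
    (hanti : ∀ i, d (i + 1) ≤ d i) (hsum : Summable fun i => d i ^ 2)
    (htot : ∑' i, d i ^ 2 ≤ s ^ 2) :
    ∃ x y : ℕ → ℝ, (∀ i, 0 ≤ x i ∧ x i + d i ≤ s) ∧ (∀ i, 0 ≤ y i ∧ y i + d i ≤ 3 * s) ∧
      ∀ i j, i < j → x i + d i ≤ x j ∨ y i + d i ≤ y j := by
  have hle (i : ℕ) : d i ≤ s := by
    have h := hsum.le_tsum i fun j _ => sq_nonneg (d j)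
    exact (pow_le_pow_iff_left₀ (hd i).le hs.le two_ne_zero).1 (h.trans htot)
  set f := shelfPacking s d with hf
  have hsucc (i : ℕ) : ((f i).1 + d i + d (i + 1) ≤ s ∧
      f (i + 1) = ((f i).1 + d i, (f i).2.1, (f i).2.2)) ∨
      (s < (f i).1 + d i + d (i + 1) ∧ f (i + 1) = (0, (f i).2.2, (f i).2.2 + d (i + 1))) := by
    by_cases h : (f i).1 + d i + d (i + 1) ≤ s
    · exact .inl ⟨h, by simp only [hf, shelfPacking] at h ⊢; rw [if_pos h]⟩
    · exact .inr ⟨not_le.1 h, by simp only [hf, shelfPacking] at h ⊢; rw [if_neg h]⟩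
  have hbox (i : ℕ) : 0 ≤ (f i).1 ∧ (f i).1 + d i ≤ s ∧ 0 ≤ (f i).2.1 ∧
      (f i).2.1 + d i ≤ (f i).2.2 := by
    induction i with
    | zero => simp [hf, shelfPacking, hle]
    | succ i ih =>
      have h1 := hd i
      have h2 := hd (i + 1)
      have h3 := hanti i
      have h4 := hle (i + 1)
      obtain ⟨h, e⟩ | ⟨h, e⟩ := hsucc i <;> rw [e] <;> refine ⟨?_, ?_, ?_, ?_⟩ <;>
        dsimp only <;> linarith
  have harea (i : ℕ) : s * ((f i).2.2 - d 0) + ((f i).1 + d i) * d i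
      ≤ 2 * ∑ k ∈ Finset.range (i + 1), d k ^ 2 := by
    induction i with
    | zero =>
      simp only [hf, shelfPacking, zero_add, Finset.sum_range_one]
      nlinarith [sq_nonneg (d 0)]
    | succ i ih =>
      rw [Finset.sum_range_succ]
      have h1 := hd i
      have h2 := hd (i + 1)
      have h3 : ((f i).1 + d i) * d (i + 1) ≤ ((f i).1 + d i) * d i :=
        mul_le_mul_of_nonneg_left (hanti i) (by linarith [(hbox i).1])
      obtain ⟨h, e⟩ | ⟨h, e⟩ := hsucc i <;> rw [e] <;> dsimp only
      · nlinarith [sq_nonneg (d (i + 1))]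
      · nlinarith [mul_le_mul_of_nonneg_right h.le h2.le]
  have htop (i : ℕ) : (f i).2.2 ≤ 3 * s := by
    have h1 := harea i
    have h2 := hsum.sum_le_tsum (Finset.range (i + 1)) fun j _ => sq_nonneg (d j)
    have h3 : 0 ≤ ((f i).1 + d i) * d i :=
      mul_nonneg (by linarith [(hbox i).1, hd i]) (hd i).le
    have h4 : s * ((f i).2.2 - d 0) ≤ s * (2 * s) := by nlinarith
    linarith [le_of_mul_le_mul_left h4 hs, hle 0]
  have hsep (i k : ℕ) : ((f i).1 + d i ≤ (f (i + 1 + k)).1 ∧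
      (f (i + 1 + k)).2.2 = (f i).2.2) ∨ (f i).2.2 ≤ (f (i + 1 + k)).2.1 := by
    induction k with
    | zero => obtain ⟨h, e⟩ | ⟨h, e⟩ := hsucc i <;> simp [e]
    | succ k ih =>
      have h1 := hd (i + 1 + k)
      have h2 := (hbox (i + 1 + k)).2.2.2
      rw [← add_assoc]
      obtain ⟨h, e⟩ | ⟨h, e⟩ := hsucc (i + 1 + k) <;> rw [e] <;> dsimp only
      · exact ih.imp (fun h => ⟨by linarith [h.1], h.2⟩) id
      · exact .inr (ih.elim (fun h => h.2.ge) fun h => by linarith)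
  refine ⟨fun i => (f i).1, fun i => (f i).2.1, fun i => ⟨(hbox i).1, (hbox i).2.1⟩,
    fun i => ⟨(hbox i).2.2.1, (hbox i).2.2.2.trans (htop i)⟩, fun i j hij => ?_⟩
  obtain ⟨k, rfl⟩ := Nat.exists_eq_add_of_le (Nat.succ_le_of_lt hij)
  exact (hsep i k).imp And.left (hbox i).2.2.2.trans

theorem disjoint_Ioo_prod_Ioo {x y w h x' y' w' h' : ℝ} (H : x + w ≤ x' ∨ y + h ≤ y') :
    Disjoint (Set.Ioo x (x + w) ×ˢ Set.Ioo y (y + h))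
      (Set.Ioo x' (x' + w') ×ˢ Set.Ioo y' (y' + h')) := by
  rw [Set.disjoint_left]
  rintro ⟨u, v⟩ ⟨⟨_, h1⟩, _, h2⟩ ⟨⟨h3, _⟩, h4, _⟩
  obtain H | H := H <;> dsimp only at * <;> linarith

theorem isPositioning_of_lt {ι : Type*} [LinearOrder ι] {w l a b : ι → ℝ}
    (H : ∀ i j, i < j →
      Disjoint (Set.Ioo (a i) (a i + w i) ×ˢ Set.Ioo (b i) (b i + l i))
        (Set.Ioo (a j) (a j + w j) ×ˢ Set.Ioo (b j) (b j + l j))) :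
    IsPositioning w l a b := fun i j hij =>
  hij.lt_or_gt.elim (H i j) fun h => (H j i h).symm

theorem T0inf_le {w l a b : ℕ → ℝ} {P Q : ℝ} (hw : ∀ i, 0 < w i) (hl : ∀ i, 0 < l i)
    (hM : IsPositioning w l a b) (hP : ∀ i j, a i + w i - a j ≤ P)
    (hQ : ∀ i j, b i + l i - b j ≤ Q) : T0inf w l ≤ P * Q := by
  refine csInf_le ⟨0, ?_⟩ ⟨a, b, P, Q, hM, hP, hQ, rfl⟩
  rintro _ ⟨a', b', P', Q', -, hP', hQ', rfl⟩
  exact mul_nonneg (by linarith [hP' 0 0, hw 0]) (by linarith [hQ' 0 0, hl 0])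

/-- The intervals `[a i, a i + w i]` of a finite nonempty family all lie in one interval of
length `pval w a`. -/
theorem exists_le_add_pval {n : ℕ} (hn : 0 < n) (w a : Fin n → ℝ) :
    ∃ m, ∀ i, m ≤ a i ∧ a i + w i ≤ m + pval w a := by
  have : Nonempty (Fin n) := ⟨⟨0, hn⟩⟩
  obtain ⟨k, hk⟩ := Finite.exists_min a
  exact ⟨a k, fun i => ⟨hk i, by linarith [le_pval w a i k]⟩⟩

/-- Quantitative step in Theorem 2: with `Rₙ = ∑_{k>n} lₖ²`, whenever
`4·√Rₙ ≤ q(M)` for an optimal positioning `M` of the first `n` rectangles,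
`T₀(A) − T₀(Aⁿ) ≤ T₀(Aⁿ)·√Rₙ / w₁`. -/
theorem T0inf_sub_T0_prefix_le (w l : ℕ → ℝ)
    (hw : ∀ i, 0 < w i) (hl : ∀ i, 0 < l i)
    (hC1 : Summable fun i => l i ^ 2)
    (hC2 : ∀ i, w i ≤ l i) (hC2' : ∀ i, l (i + 1) ≤ l i)
    (n : ℕ) (a b : Fin n → ℝ)
    (hM : IsPositioning (fun i : Fin n => w i) (fun i : Fin n => l i) a b)
    (hopt : Tval (fun i : Fin n => w i) (fun i : Fin n => l i) a b
      = T0 (fun i : Fin n => w i) (fun i : Fin n => l i))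
    (hlarge : 4 * Real.sqrt (∑' k, l (n + k) ^ 2) ≤ qval (fun i : Fin n => l i) b) :
    T0inf w l - T0 (fun i : Fin n => w i) (fun i : Fin n => l i)
      ≤ T0 (fun i : Fin n => w i) (fun i : Fin n => l i)
          * Real.sqrt (∑' k, l (n + k) ^ 2) / w 0 := by
  set s := Real.sqrt (∑' k, l (n + k) ^ 2)
  set w' : Fin n → ℝ := fun i => w i
  set l' : Fin n → ℝ := fun i => l i
  have hsum : Summable fun k => l (n + k) ^ 2 := by
    simpa only [add_comm n] using (summable_nat_add_iff n).2 hC1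
  have htot : 0 < ∑' k, l (n + k) ^ 2 :=
    hsum.tsum_pos (fun k => sq_nonneg _) 0 (pow_pos (hl _) 2)
  have hs0 : 0 < s := Real.sqrt_pos.2 htot
  have hn : 0 < n := by
    rcases Nat.eq_zero_or_pos n with rfl | h
    · rw [qval, Real.iSup_of_isEmpty] at hlarge
      linarith
    · exact h
  obtain ⟨x, y, hx, hy, hxy⟩ := exists_square_packing (d := fun k => l (n + k)) hs0
    (fun k => hl _) (fun k => hC2' (n + k)) hsum (Real.sq_sqrt htot.le).ge
  obtain ⟨α, hα⟩ := exists_le_add_pval hn w' a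
  obtain ⟨β, hβ⟩ := exists_le_add_pval hn l' b
  change ∀ i, β ≤ b i ∧ b i + l' i ≤ β + qval l' b at hβ
  set p := pval w' a
  set q := qval l' b
  have hp : w 0 ≤ p := by linarith [le_pval w' a ⟨0, hn⟩ ⟨0, hn⟩, show w' ⟨0, hn⟩ = w 0 from rfl]
  have hq : 0 ≤ q := by linarith
  let A : ℕ → ℝ := fun i => if h : i < n then a ⟨i, h⟩ else α + p + x (i - n)
  let B : ℕ → ℝ := fun i => if h : i < n then b ⟨i, h⟩ else β + y (i - n)
  have hA₁ (i : Fin n) : A i = a i := dif_pos i.2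
  have hB₁ (i : Fin n) : B i = b i := dif_pos i.2
  have hA₂ (k : ℕ) : A (n + k) = α + p + x k := by simp [A]
  have hB₂ (k : ℕ) : B (n + k) = β + y k := by simp [B]
  have hcases (i : ℕ) : (∃ k : Fin n, i = k) ∨ ∃ k, i = n + k :=
    (lt_or_ge i n).imp (fun h => ⟨⟨i, h⟩, rfl⟩) Nat.exists_eq_add_of_le
  have hAbox (i : ℕ) : α ≤ A i ∧ A i + w i ≤ α + (p + s) := by
    obtain ⟨k, rfl⟩ | ⟨k, rfl⟩ := hcases i
    · rw [hA₁]
      exact ⟨(hα k).1, by linarith [(hα k).2, show w' k = w k from rfl]⟩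
    · rw [hA₂]
      exact ⟨by linarith [(hx k).1, hw 0], by linarith [(hx k).2, hC2 (n + k)]⟩
  have hBbox (i : ℕ) : β ≤ B i ∧ B i + l i ≤ β + q := by
    obtain ⟨k, rfl⟩ | ⟨k, rfl⟩ := hcases i
    · rw [hB₁]
      exact hβ k
    · rw [hB₂]
      exact ⟨by linarith [(hy k).1], by linarith [(hy k).2]⟩
  have hAB : IsPositioning w l A B := by
    refine isPositioning_of_lt fun i j hij => ?_
    obtain ⟨u, rfl⟩ | ⟨u, rfl⟩ := hcases i <;> obtain ⟨v, rfl⟩ | ⟨v, rfl⟩ := hcases j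
    · simp only [hA₁, hB₁]
      exact hM u v (Fin.lt_def.2 hij).ne
    · refine disjoint_Ioo_prod_Ioo (.inl ?_)
      rw [hA₁, hA₂]
      linarith [(hα u).2, (hx v).1, show w' u = w u from rfl]
    · have := v.2
      omega
    · refine disjoint_Ioo_prod_Ioo ?_
      rw [hA₂, hA₂, hB₂, hB₂]
      refine (hxy u v (by omega)).imp (fun h => ?_) fun h => ?_
      · linarith [hC2 (n + u)]
      · linarith
  have hT : T0inf w l ≤ (p + s) * q := T0inf_le hw hl hAB
    (fun i j => by linarith [(hAbox i).2, (hAbox j).1])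
    (fun i j => by linarith [(hBbox i).2, (hBbox j).1])
  rw [← hopt, Tval, le_div_iff₀ (hw 0)]
  calc (T0inf w l - p * q) * w 0 ≤ q * s * w 0 :=
        mul_le_mul_of_nonneg_right (by linarith) (hw 0).le
    _ ≤ q * s * p := mul_le_mul_of_nonneg_left hp (mul_nonneg hq hs0.le)
    _ = p * q * s := by ring
end
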